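/- Let A be a subset of the set P_PU of pseudoultrametric-preserving functions ℝ≥0 → ℝ≥0, let X := { g ∘ d⁺ : g ∈ A } (a set of pseudoultrametrics on ℝ≥0, where d⁺(p,q) = 0 if p = q and max(p,q) otherwise), let [A] denote the subsemigroup of (P_PU, ∘) generated by A, and let R̄ be the union of all right ideals R of [A] with R ⊆ A. If the identity map Id on ℝ≥0 belongs to A ∩ R̄, then R̄ = P_X, where P_X is the set of all functions f : ℝ≥0 → ℝ≥0 such that f ∘ ρ ∈ X for every ρ ∈ X. -/

import Mathlib

open NNReal

universe u

/-- `d : Y → Y → ℝ≥0` is a pseudoultrametric on `Y`. -/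
def IsPseudoUltrametric {Y : Type u} (d : Y → Y → ℝ≥0) : Prop :=
  (∀ x, d x x = 0) ∧
  (∀ x y, d x y = d y x) ∧
  (∀ x y z, d x y ≤ max (d x z) (d z y))

/-- `f : ℝ≥0 → ℝ≥0` is pseudoultrametric-preserving. -/
def PseudoUltrametricPreserving (f : ℝ≥0 → ℝ≥0) : Prop :=
  ∀ (Y : Type u) (d : Y → Y → ℝ≥0), IsPseudoUltrametric d →
    IsPseudoUltrametric (fun x y => f (d x y))

/-- The ultrametric `d⁺` on `ℝ≥0`. -/
noncomputable def dPlus (p q : ℝ≥0) : ℝ≥0 := if p = q then 0 else max p q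

/-- For a set `X` of pseudoultrametrics on `ℝ≥0`, `PX X` is the set of all
functions `f : ℝ≥0 → ℝ≥0` with `f ∘ ρ ∈ X` for every `ρ ∈ X`. -/
def PX (X : Set (ℝ≥0 → ℝ≥0 → ℝ≥0)) : Set (ℝ≥0 → ℝ≥0) :=
  {f | ∀ ρ ∈ X, (fun p q => f (ρ p q)) ∈ X}

/-- The subsemigroup (under composition) generated by a set `A` of functions:
the smallest composition-closed set of functions containing `A`. -/
def genSub (A : Set (ℝ≥0 → ℝ≥0)) : Set (ℝ≥0 → ℝ≥0) :=
  ⋂₀ {T | A ⊆ T ∧ ∀ f ∈ T, ∀ g ∈ T, f ∘ g ∈ T}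

/-- The union `R̄` of all right ideals of `[A]` (the subsemigroup of `(P_PU, ∘)`
generated by `A`) that are contained in `A`. -/
def Rbar (A : Set (ℝ≥0 → ℝ≥0)) : Set (ℝ≥0 → ℝ≥0) :=
  ⋃₀ {R | R.Nonempty ∧ R ⊆ A ∧ ∀ r ∈ R, ∀ s ∈ genSub A, r ∘ s ∈ R}

theorem dPlus_zero_left (x : ℝ≥0) : dPlus 0 x = x := by
  unfold dPlus
  split_ifs with h
  · exact h
  · exact max_eq_right zero_le

theorem subset_genSub (A : Set (ℝ≥0 → ℝ≥0)) : A ⊆ genSub A :=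
  Set.subset_sInter fun _ hT => hT.1

theorem genSub_comp_mem {A : Set (ℝ≥0 → ℝ≥0)} {f g : ℝ≥0 → ℝ≥0}
    (hf : f ∈ genSub A) (hg : g ∈ genSub A) : f ∘ g ∈ genSub A :=
  fun T hT => hT.2 f (hf T hT) g (hg T hT)

theorem Rbar_subset (A : Set (ℝ≥0 → ℝ≥0)) : Rbar A ⊆ A :=
  Set.sUnion_subset fun _ hR => hR.2.1

/-- A right ideal containing the identity is everything, so `[A] ⊆ A`. -/
theorem genSub_subset_of_id_mem_Rbar {A : Set (ℝ≥0 → ℝ≥0)}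
    (hid : (id : ℝ≥0 → ℝ≥0) ∈ Rbar A) : genSub A ⊆ A := by
  obtain ⟨R, ⟨-, hRA, hR⟩, hidR⟩ := hid
  exact fun s hs => hRA (hR id hidR s hs)

theorem comp_mem_of_id_mem_Rbar {A : Set (ℝ≥0 → ℝ≥0)}
    (hid : (id : ℝ≥0 → ℝ≥0) ∈ Rbar A) {f g : ℝ≥0 → ℝ≥0} (hf : f ∈ A) (hg : g ∈ A) :
    f ∘ g ∈ A :=
  genSub_subset_of_id_mem_Rbar hid
    (genSub_comp_mem (subset_genSub A hf) (subset_genSub A hg))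

theorem Rbar_eq_of_id_mem_Rbar {A : Set (ℝ≥0 → ℝ≥0)}
    (hid : (id : ℝ≥0 → ℝ≥0) ∈ Rbar A) : Rbar A = A :=
  (Rbar_subset A).antisymm fun f hf =>
    ⟨A, ⟨⟨f, hf⟩, subset_rfl, fun _ hr _ hs =>
      comp_mem_of_id_mem_Rbar hid hr (genSub_subset_of_id_mem_Rbar hid hs)⟩, hf⟩

/-- if `A ⊆ P_PU`, `X = {g ∘ d⁺ : g ∈ A}` and the identity map
belongs to `A ∩ R̄`, then `R̄ = P_X`. -/
theorem Rbar_eq_PX (A : Set (ℝ≥0 → ℝ≥0))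
    (hA : ∀ f ∈ A, PseudoUltrametricPreserving.{u} f)
    (hid : (id : ℝ≥0 → ℝ≥0) ∈ A ∩ Rbar A) :
    Rbar A = PX {ρ | ∃ g ∈ A, ρ = fun p q => g (dPlus p q)} := by
  rw [Rbar_eq_of_id_mem_Rbar hid.2]
  ext f
  constructor
  · rintro hf ρ ⟨g, hg, rfl⟩
    exact ⟨f ∘ g, comp_mem_of_id_mem_Rbar hid.2 hf hg, rfl⟩
  · intro hf
    obtain ⟨h, hh, hfh⟩ := hf _ ⟨id, hid.1, rfl⟩
    have hEq : f = h := by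
      funext x
      have hx := congrFun (congrFun hfh 0) x
      simpa only [id, dPlus_zero_left] using hx
    exact hEq ▸ hh
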